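/- If t is a positive integer with t ≢ 0 (mod 3), then there does not exist a skew starter in Z_{3t}. -/

import Mathlib

/-- The family `f`, indexed by `Fin m ⊕ Fin m`, hits each element of `G \\ H`
exactly once. -/
def CoversComplement {G : Type*} [AddCommGroup G] (H : AddSubgroup G) {m : ℕ}
    (f : Fin m ⊕ Fin m → G) : Prop :=
  Function.Injective f ∧ Set.range f = {z : G | z ∉ H}

/-- The pairs `{x i, y i}` form a frame starter in `G \\ H`: the entries hit each
element of `G \\ H` exactly once, and so do the differences `±(x i - y i)`. -/
def IsFrameStarter {G : Type*} [AddCommGroup G] (H : AddSubgroup G) {m : ℕ}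
    (x y : Fin m → G) : Prop :=
  CoversComplement H (Sum.elim x y) ∧
    CoversComplement H (Sum.elim (fun i => x i - y i) (fun i => y i - x i))

/-- A frame starter is strong if the sums `x i + y i` avoid `H` and are pairwise
distinct. -/
def IsStrongFS {G : Type*} [AddCommGroup G] (H : AddSubgroup G) {m : ℕ}
    (x y : Fin m → G) : Prop :=
  (∀ i, x i + y i ∉ H) ∧ Function.Injective fun i => x i + y i

/-- A frame starter is skew if the sums `±(x i + y i)` hit each element of
`G \\ H` exactly once. -/
def IsSkewFS {G : Type*} [AddCommGroup G] (H : AddSubgroup G) {m : ℕ}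
    (x y : Fin m → G) : Prop :=
  CoversComplement H (Sum.elim (fun i => x i + y i) (fun i => -(x i + y i)))

/-- Summing a function that vanishes at `0` along a family covering the nonzero elements
gives its sum over the whole group. -/
theorem CoversComplement.sum_comp {G M : Type*} [AddCommGroup G] [Fintype G] [AddCommMonoid M]
    {m : ℕ} {f : Fin m ⊕ Fin m → G} (hf : CoversComplement (⊥ : AddSubgroup G) f)
    (g : G → M) (hg : g 0 = 0) : ∑ i, g (f i) = ∑ z, g z := by
  refine Finset.sum_of_injOn f hf.1.injOn (by simp) (fun z _ hz => ?_) (fun _ _ => rfl)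
  by_contra h
  have hmem : z ∈ Set.range f := by
    rw [hf.2]
    rintro hz0
    exact h (by rw [AddSubgroup.mem_bot.mp hz0, hg])
  exact hz (by simpa using hmem)

/-- The squares of a skew starter's group, transported to any commutative ring, have a sum
annihilated by `2`. -/
theorem two_mul_sum_sq_eq_zero_of_isSkewFS {G R : Type*} [AddCommGroup G] [Fintype G] [CommRing R]
    {m : ℕ} {x y : Fin m → G} (hxy : IsFrameStarter (⊥ : AddSubgroup G) x y)
    (hs : IsSkewFS (⊥ : AddSubgroup G) x y) (φ : G →+ R) : 2 * ∑ z, φ z ^ 2 = 0 := by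
  have hφ : φ 0 ^ 2 = 0 := by simp
  have hentries := hxy.1.sum_comp (φ · ^ 2) hφ
  have hdiffs := hxy.2.sum_comp (φ · ^ 2) hφ
  have hsums := CoversComplement.sum_comp hs (φ · ^ 2) hφ
  simp only [Fintype.sum_sum_type, Sum.elim_inl, Sum.elim_inr, map_add, map_sub, map_neg,
    ← Finset.sum_add_distrib] at hentries hdiffs hsums
  have hparallelogram : ∑ i, ((φ (x i) - φ (y i)) ^ 2 + (φ (y i) - φ (x i)) ^ 2) +
      ∑ i, ((φ (x i) + φ (y i)) ^ 2 + (-(φ (x i) + φ (y i))) ^ 2) =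
      4 * ∑ i, (φ (x i) ^ 2 + φ (y i) ^ 2) := by
    rw [← Finset.sum_add_distrib, Finset.mul_sum]
    exact Finset.sum_congr rfl fun i _ => by ring
  rw [hentries, hdiffs, hsums] at hparallelogram
  linear_combination -hparallelogram

theorem sum_range_three_mul_sq (t : ℕ) :
    ∑ i ∈ Finset.range (3 * t), (i : ZMod 3) ^ 2 = 2 * t := by
  induction t with
  | zero => simp
  | succ t ih =>
    have h3 : (3 : ZMod 3) = 0 := rfl
    rw [Nat.mul_succ, Finset.sum_range_succ, Finset.sum_range_succ, Finset.sum_range_succ, ih]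
    push_cast
    linear_combination (9 * (t : ZMod 3) ^ 2 + 6 * (t : ZMod 3) + 1) * h3

theorem sum_castHom_sq (t : ℕ) [NeZero (3 * t)] :
    ∑ z : ZMod (3 * t), ZMod.castHom (Dvd.intro t rfl) (ZMod 3) z ^ 2 = 2 * t := by
  rw [← sum_range_three_mul_sq]
  refine Finset.sum_nbij' ZMod.val Nat.cast ?_ ?_ ?_ ?_ ?_
  · exact fun z _ => Finset.mem_range.mpr (ZMod.val_lt z)
  · simp
  · simp
  · exact fun i hi => ZMod.val_cast_of_lt (Finset.mem_range.mp hi)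
  · intro z _
    rw [ZMod.castHom_apply, ZMod.natCast_val]

/-- If `t ≢ 0 (mod 3)`, then there is no skew starter in
`ℤ_{3t}`. -/
theorem stmt13 (t : ℕ) (ht : 0 < t) (hmod : ¬ 3 ∣ t) :
    ¬ ∃ (m : ℕ) (x y : Fin m → ZMod (3 * t)),
      IsFrameStarter (⊥ : AddSubgroup (ZMod (3 * t))) x y ∧
        IsSkewFS (⊥ : AddSubgroup (ZMod (3 * t))) x y := by
  rintro ⟨m, x, y, hxy, hs⟩
  have : NeZero (3 * t) := ⟨by omega⟩
  have h := two_mul_sum_sq_eq_zero_of_isSkewFS hxy hs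
    (ZMod.castHom (Dvd.intro t rfl) (ZMod 3)).toAddMonoidHom
  have hsum := sum_castHom_sq t
  simp only [RingHom.toAddMonoidHom_eq_coe, AddMonoidHom.coe_coe] at h
  rw [hsum] at h
  have h3 : (3 : ZMod 3) = 0 := rfl
  exact hmod ((ZMod.natCast_eq_zero_iff t 3).mp (by linear_combination h - t * h3))
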